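/- Let P be a process LTS and E an environment LTS over the same action set A. For all image-finite processes p, q of P and every image-finite environment e of E: p ji≃_e q (equivalently, p ≃_e q) if and only if L(p) ∩ L(e) = L(q) ∩ L(e), where L denotes the set of positive modal formulas satisfied by a state. Moreover the implication from p ji≃_e q to the equality of formula sets holds for all (not necessarily image-finite) p, q, e. -/

import Mathlib

/-- A simulation from the LTS `tr1` to the LTS `tr2` (over the same action set). -/
def IsSim {A St1 St2 : Type*} (tr1 : St1 → A → St1 → Prop)
    (tr2 : St2 → A → St2 → Prop) (S : St1 → St2 → Prop) : Prop :=
  ∀ s t, S s t → ∀ a s', tr1 s a s' → ∃ t', tr2 t a t' ∧ S s' t'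

/-- `s` can be simulated by `t`. -/
def SimBy {A St1 St2 : Type*} (tr1 : St1 → A → St1 → Prop)
    (tr2 : St2 → A → St2 → Prop) (s : St1) (t : St2) : Prop :=
  ∃ S, IsSim tr1 tr2 S ∧ S s t

/-- A bisimulation on the LTS `tr`: both `B` and its converse are simulations. -/
def IsBisim {A St : Type*} (tr : St → A → St → Prop) (B : St → St → Prop) : Prop :=
  IsSim tr tr B ∧ IsSim tr tr (fun t s => B s t)

/-- `s` and `t` are bisimilar. -/
def Bisim {A St : Type*} (tr : St → A → St → Prop) (s t : St) : Prop :=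
  ∃ B, IsBisim tr B ∧ B s t

/-- The join-interaction LTS `T1 & T2`: simultaneous equally-labeled transitions. -/
def joinTr {A St1 St2 : Type*} (tr1 : St1 → A → St1 → Prop)
    (tr2 : St2 → A → St2 → Prop) : St1 × St2 → A → St1 × St2 → Prop :=
  fun s a s' => tr1 s.1 a s'.1 ∧ tr2 s.2 a s'.2

/-- The right-determinizing join LTS `P ⊕ E`: actions are pairs `(a, e')`
    recording the target of the environment transition. -/
def dotTr {A Pr Env : Type*} (tr : Pr → A → Pr → Prop)
    (trE : Env → A → Env → Prop) : Pr × Env → A × Env → Pr × Env → Prop :=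
  fun s l s' => tr s.1 l.1 s'.1 ∧ trE s.2 l.1 s'.2 ∧ s'.2 = l.2

/-- An `E`-parameterized simulation on the process LTS `tr`. -/
def IsParamSim {A Pr Env : Type*} (tr : Pr → A → Pr → Prop)
    (trE : Env → A → Env → Prop) (S : Env → Pr → Pr → Prop) : Prop :=
  ∀ e p q, S e p q → ∀ a e', trE e a e' → ∀ p', tr p a p' →
    ∃ q', tr q a q' ∧ S e' p' q'

/-- `p ⊑_e q`: `p` can be simulated by `q` with respect to environment `e`. -/
def ParamSimBy {A Pr Env : Type*} (tr : Pr → A → Pr → Prop)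
    (trE : Env → A → Env → Prop) (e : Env) (p q : Pr) : Prop :=
  ∃ S, IsParamSim tr trE S ∧ S e p q

/-- An `E`-parameterized bisimulation on the process LTS `tr`. -/
def IsParamBisim {A Pr Env : Type*} (tr : Pr → A → Pr → Prop)
    (trE : Env → A → Env → Prop) (B : Env → Pr → Pr → Prop) : Prop :=
  ∀ e p q, B e p q → ∀ a e', trE e a e' →
    ((∀ p', tr p a p' → ∃ q', tr q a q' ∧ B e' p' q') ∧
     (∀ q', tr q a q' → ∃ p', tr p a p' ∧ B e' p' q'))

/-- `p ∼_e q`: `p` and `q` are bisimilar with respect to environment `e`. -/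
def ParamBisim {A Pr Env : Type*} (tr : Pr → A → Pr → Prop)
    (trE : Env → A → Env → Prop) (e : Env) (p q : Pr) : Prop :=
  ∃ B, IsParamBisim tr trE B ∧ B e p q

/-- Reachability via a path of transitions. -/
def Reachable {A St : Type*} (tr : St → A → St → Prop) : St → St → Prop :=
  Relation.ReflTransGen (fun s t => ∃ a, tr s a t)

/-- A state is deterministic if every reachable state has at most one
    `a`-derivative, for each action `a`. -/
def Deterministic {A St : Type*} (tr : St → A → St → Prop) (s : St) : Prop :=
  ∀ t, Reachable tr s t → ∀ (a : A) (t1 t2 : St), tr t a t1 → tr t a t2 → t1 = t2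

/-- A state is image-finite if every reachable state has only finitely many
    `a`-derivatives, for each action `a`. -/
def ImageFinite {A St : Type*} (tr : St → A → St → Prop) (s : St) : Prop :=
  ∀ t, Reachable tr s t → ∀ a : A, {t' | tr t a t'}.Finite

/-- Positive modal formulas: `⊤`, conjunction, diamond modalities. -/
inductive PosForm (A : Type*) where
  | top : PosForm A
  | and : PosForm A → PosForm A → PosForm A
  | dia : A → PosForm A → PosForm A

/-- Satisfaction of positive formulas. -/
def psat {A St : Type*} (tr : St → A → St → Prop) : PosForm A → St → Prop
  | .top, _ => True
  | .and φ ψ, s => psat tr φ s ∧ psat tr ψ s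
  | .dia a φ, s => ∃ s', tr s a s' ∧ psat tr φ s'

/-- The set of positive formulas satisfied by a state. -/
def posSat {A St : Type*} (tr : St → A → St → Prop) (s : St) : Set (PosForm A) :=
  {φ | psat tr φ s}

/-- Simple modal formulas: `⊤`, negation, conjunction, diamond modalities. -/
inductive Form (A : Type*) where
  | top : Form A
  | neg : Form A → Form A
  | and : Form A → Form A → Form A
  | dia : A → Form A → Form A

/-- Satisfaction of modal formulas. -/
def msat {A St : Type*} (tr : St → A → St → Prop) : Form A → St → Prop
  | .top, _ => True
  | .neg φ, s => ¬ msat tr φ s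
  | .and φ ψ, s => msat tr φ s ∧ msat tr ψ s
  | .dia a φ, s => ∃ s', tr s a s' ∧ msat tr φ s'

/-- The set of modal formulas satisfied by a state. -/
def modalSat {A St : Type*} (tr : St → A → St → Prop) (s : St) : Set (Form A) :=
  {φ | msat tr φ s}

/-- The positive-formula projection, erasing negations. -/
def posProj {A : Type*} : Form A → PosForm A
  | .top => .top
  | .neg φ => posProj φ
  | .and φ ψ => .and (posProj φ) (posProj ψ)
  | .dia a φ => .dia a (posProj φ)

/-- Negation closure of a set of positive formulas. -/
def negClosure {A : Type*} (Φ : Set (PosForm A)) : Set (Form A) :=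
  {ψ | posProj ψ ∈ Φ}

theorem SimBy.exists_step {A St1 St2 : Type*} {tr1 : St1 → A → St1 → Prop}
    {tr2 : St2 → A → St2 → Prop} {s s' : St1} {t : St2} {a : A}
    (h : SimBy tr1 tr2 s t) (hs : tr1 s a s') : ∃ t', tr2 t a t' ∧ SimBy tr1 tr2 s' t' := by
  obtain ⟨S, hS, hst⟩ := h
  obtain ⟨t', ht, hst'⟩ := hS s t hst a s' hs
  exact ⟨t', ht, S, hS, hst'⟩

theorem simBy_joinTr_iff_paramSimBy {A Pr Env : Type*} (tr : Pr → A → Pr → Prop)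
    (trE : Env → A → Env → Prop) (p q : Pr) (e : Env) :
    SimBy (joinTr tr trE) (joinTr tr trE) (p, e) (q, e) ↔ ParamSimBy tr trE e p q := by
  constructor
  · intro h
    refine ⟨fun e p q => ∃ f, SimBy (joinTr tr trE) (joinTr tr trE) (p, e) (q, f), ?_, e, h⟩
    rintro e p q ⟨f, hf⟩ a e' he p' hp
    obtain ⟨⟨q', f'⟩, hq, hs⟩ := hf.exists_step (a := a) (s' := (p', e')) ⟨hp, he⟩
    exact ⟨q', hq.1, f', hs⟩
  · rintro ⟨S, hS, h⟩
    refine ⟨fun s t => s.2 = t.2 ∧ S s.2 s.1 t.1, ?_, rfl, h⟩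
    rintro ⟨p, e⟩ ⟨q, f⟩ ⟨rfl, hs⟩ a ⟨p', e'⟩ ⟨hp, he⟩
    obtain ⟨q', hq, hs'⟩ := hS e p q hs a e' he p' hp
    exact ⟨(q', e'), ⟨hq, he⟩, rfl, hs'⟩

theorem psat_joinTr {A St1 St2 : Type*} (tr1 : St1 → A → St1 → Prop)
    (tr2 : St2 → A → St2 → Prop) (φ : PosForm A) (s : St1) (t : St2) :
    psat (joinTr tr1 tr2) φ (s, t) ↔ psat tr1 φ s ∧ psat tr2 φ t := by
  induction φ generalizing s t with
  | top => simp [psat]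
  | and φ ψ ihφ ihψ =>
    simp only [psat, ihφ, ihψ]
    tauto
  | dia a φ ih =>
    simp only [psat, Prod.exists, ih, joinTr]
    constructor
    · rintro ⟨s', t', ⟨hs, ht⟩, hs', ht'⟩
      exact ⟨⟨s', hs, hs'⟩, t', ht, ht'⟩
    · rintro ⟨⟨s', hs, hs'⟩, t', ht, ht'⟩
      exact ⟨s', t', ⟨hs, ht⟩, hs', ht'⟩

theorem posSat_joinTr {A St1 St2 : Type*} (tr1 : St1 → A → St1 → Prop)
    (tr2 : St2 → A → St2 → Prop) (s : St1) (t : St2) :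
    posSat (joinTr tr1 tr2) (s, t) = posSat tr1 s ∩ posSat tr2 t :=
  Set.ext fun φ => psat_joinTr tr1 tr2 φ s t

theorem SimBy.posSat_subset {A St1 St2 : Type*} {tr1 : St1 → A → St1 → Prop}
    {tr2 : St2 → A → St2 → Prop} {s : St1} {t : St2} (h : SimBy tr1 tr2 s t) :
    posSat tr1 s ⊆ posSat tr2 t := by
  intro φ hφ
  change psat tr1 φ s at hφ
  change psat tr2 φ t
  induction φ generalizing s t with
  | top => trivial
  | and φ ψ ihφ ihψ => exact ⟨ihφ h hφ.1, ihψ h hφ.2⟩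
  | dia a φ ih =>
    obtain ⟨s', hs, hs'⟩ := hφ
    obtain ⟨t', ht, hst⟩ := h.exists_step hs
    exact ⟨t', ht, ih hst hs'⟩

theorem ImageFinite.of_tr {A St : Type*} {tr : St → A → St → Prop} {s s' : St} {a : A}
    (h : ImageFinite tr s) (hs : tr s a s') : ImageFinite tr s' :=
  fun t ht => h t (Relation.ReflTransGen.head ⟨a, hs⟩ ht)

theorem ImageFinite.joinTr {A St1 St2 : Type*} {tr1 : St1 → A → St1 → Prop}
    {tr2 : St2 → A → St2 → Prop} {s : St1} {t : St2}
    (hs : ImageFinite tr1 s) (ht : ImageFinite tr2 t) :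
    ImageFinite (joinTr tr1 tr2) (s, t) := by
  rintro ⟨u, v⟩ h a
  have hu : Reachable tr1 s u := Relation.ReflTransGen.lift Prod.fst
    (fun _ _ ⟨b, hb⟩ => ⟨b, hb.1⟩) _ _ h
  have hv : Reachable tr2 t v := Relation.ReflTransGen.lift Prod.snd
    (fun _ _ ⟨b, hb⟩ => ⟨b, hb.2⟩) _ _ h
  exact (hs u hu a).prod (ht v hv a)

/-- Finitely many states, each failing some positive formula satisfied by `s`,
    can be separated from `s` by a single positive formula. -/
theorem exists_psat_forall_not_psat {A St1 St2 : Type*} (tr1 : St1 → A → St1 → Prop)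
    (tr2 : St2 → A → St2 → Prop) (s : St1) {F : Set St2} (hF : F.Finite)
    (h : ∀ t ∈ F, ¬ posSat tr1 s ⊆ posSat tr2 t) :
    ∃ φ, psat tr1 φ s ∧ ∀ t ∈ F, ¬ psat tr2 φ t := by
  induction F, hF using Set.Finite.induction_on with
  | empty => exact ⟨.top, trivial, by simp⟩
  | @insert t F _ _ ih =>
    obtain ⟨φ, hφ, hF⟩ := ih fun u hu => h u (Set.mem_insert_of_mem t hu)
    obtain ⟨ψ, hψ, ht⟩ := Set.not_subset.mp (h t (Set.mem_insert t F))
    refine ⟨.and ψ φ, ⟨hψ, hφ⟩, ?_⟩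
    rintro u (rfl | hu) hsat
    · exact ht hsat.1
    · exact hF u hu hsat.2

theorem ImageFinite.simBy_of_posSat_subset {A St1 St2 : Type*} {tr1 : St1 → A → St1 → Prop}
    {tr2 : St2 → A → St2 → Prop} {s : St1} {t : St2} (ht : ImageFinite tr2 t)
    (h : posSat tr1 s ⊆ posSat tr2 t) : SimBy tr1 tr2 s t := by
  refine ⟨fun s t => ImageFinite tr2 t ∧ posSat tr1 s ⊆ posSat tr2 t, ?_, ht, h⟩
  rintro s t ⟨ht, h⟩ a s' hs
  by_contra! hcon
  obtain ⟨φ, hφ, hF⟩ := exists_psat_forall_not_psat tr1 tr2 s'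
    (ht t Relation.ReflTransGen.refl a) fun u hu => hcon u hu (ht.of_tr hu)
  have hdia : PosForm.dia a φ ∈ posSat tr2 t := h ⟨s', hs, hφ⟩
  obtain ⟨t', ht', hsat⟩ := hdia
  exact hF t' ht' hsat

theorem stmt17 {A Pr Env : Type*} (tr : Pr → A → Pr → Prop)
    (trE : Env → A → Env → Prop) :
    (∀ (p q : Pr) (e : Env),
        (SimBy (joinTr tr trE) (joinTr tr trE) (p, e) (q, e) ∧
         SimBy (joinTr tr trE) (joinTr tr trE) (q, e) (p, e)) ↔
          (ParamSimBy tr trE e p q ∧ ParamSimBy tr trE e q p)) ∧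
    (∀ (p q : Pr) (e : Env),
        (SimBy (joinTr tr trE) (joinTr tr trE) (p, e) (q, e) ∧
         SimBy (joinTr tr trE) (joinTr tr trE) (q, e) (p, e)) →
          posSat tr p ∩ posSat trE e = posSat tr q ∩ posSat trE e) ∧
    (∀ (p q : Pr) (e : Env),
        ImageFinite tr p → ImageFinite tr q → ImageFinite trE e →
        ((SimBy (joinTr tr trE) (joinTr tr trE) (p, e) (q, e) ∧
          SimBy (joinTr tr trE) (joinTr tr trE) (q, e) (p, e)) ↔
          posSat tr p ∩ posSat trE e = posSat tr q ∩ posSat trE e)) := by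
  have sound (p q : Pr) (e : Env)
      (h : SimBy (joinTr tr trE) (joinTr tr trE) (p, e) (q, e) ∧
        SimBy (joinTr tr trE) (joinTr tr trE) (q, e) (p, e)) :
      posSat tr p ∩ posSat trE e = posSat tr q ∩ posSat trE e := by
    rw [← posSat_joinTr, ← posSat_joinTr]
    exact h.1.posSat_subset.antisymm h.2.posSat_subset
  refine ⟨fun p q e => and_congr (simBy_joinTr_iff_paramSimBy tr trE p q e)
    (simBy_joinTr_iff_paramSimBy tr trE q p e), sound,
    fun p q e hp hq he => ⟨sound p q e, fun h => ?_⟩⟩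
  rw [← posSat_joinTr, ← posSat_joinTr] at h
  exact ⟨(hq.joinTr he).simBy_of_posSat_subset h.subset,
    (hp.joinTr he).simBy_of_posSat_subset h.superset⟩
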